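/- Let A be a finite reflexive graph with p vertices (equivalently, p loops) and m non-loop edges (ordered pairs (x, y) with x ≠ y in the edge relation). For every k ≥ 1 and every finite reflexive graph B there exists a finite reflexive graph C such that for every coloring χ : Quot(C, A) → Fin k there exists a quotient map w : C → B for which the set {χ(f ∘ w) : f ∈ Quot(B, A)} has at most p!·m! elements. (Finite reflexive graphs have dual small Ramsey degrees at most p!·m! with respect to quotient maps.) -/

import Mathlib

/-- A quotient map between relational structures: a surjective map which preserves
and reflects the relation. -/
def IsQuot {V W : Type*} (ρ : V → V → Prop) (σ : W → W → Prop) (f : V → W) : Prop :=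
  Function.Surjective f ∧ (∀ x y, ρ x y → σ (f x) (f y)) ∧
    ∀ u v, σ u v → ∃ x y, ρ x y ∧ f x = u ∧ f y = v

/-- A reflexive graph relation: reflexive and symmetric. -/
def IsGraphRel {V : Type*} (ρ : V → V → Prop) : Prop :=
  Reflexive ρ ∧ Symmetric ρ

/-- Restricted growth words: `RG a w b` says that, starting with the letters below `a` known,
each letter of `w` is known or the next new one, and at the end the letters below `b` are known. -/
inductive RG : ℕ → List ℕ → ℕ → Prop
  | nil (a : ℕ) : RG a [] a
  | old {a b x : ℕ} {w : List ℕ} : x < a → RG a w b → RG a (x :: w) b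
  | new {a b : ℕ} {w : List ℕ} : RG (a + 1) w b → RG a (a :: w) b

theorem RG.append {a b c : ℕ} {u v : List ℕ} (h : RG a u b) (h' : RG b v c) :
    RG a (u ++ v) c := by
  induction h with
  | nil a => exact h'
  | old hx _ ih => exact RG.old hx (ih h')
  | new _ ih => exact RG.new (ih h')

theorem RG.le {a b : ℕ} {u : List ℕ} (h : RG a u b) : a ≤ b := by
  induction h with
  | nil a => exact le_rfl
  | old hx _ ih => exact ih
  | new _ ih => omega

theorem RG.lt {a b : ℕ} {u : List ℕ} (h : RG a u b) : ∀ x ∈ u, x < b := by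
  induction h with
  | nil a => simp
  | old hx h ih =>
    intro y hy
    rcases List.mem_cons.1 hy with rfl | hy
    · exact lt_of_lt_of_le hx h.le
    · exact ih y hy
  | new h ih =>
    intro y hy
    rcases List.mem_cons.1 hy with rfl | hy
    · exact h.le
    · exact ih y hy

theorem RG.const {a : ℕ} {u : List ℕ} (h : ∀ x ∈ u, x < a) : RG a u a := by
  induction u with
  | nil => exact RG.nil a
  | cons x u ih =>
    exact RG.old (h x (by simp)) (ih fun y hy => h y (by simp [hy]))

theorem RG.decomp {s b : ℕ} {f : List ℕ} (h : RG s f b) :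
    ∀ t, s ≤ t → t < b → ∃ f₁ f₂, f = f₁ ++ t :: f₂ ∧ RG s f₁ t ∧ RG (t + 1) f₂ b := by
  induction h with
  | nil a => intro t h1 h2; omega
  | @old a b x w hx h ih =>
    intro t h1 h2
    obtain ⟨f₁, f₂, rfl, h3, h4⟩ := ih t h1 h2
    exact ⟨x :: f₁, f₂, rfl, RG.old hx h3, h4⟩
  | @new a b w h ih =>
    intro t h1 h2
    rcases h1.eq_or_lt with rfl | h1
    · exact ⟨[], w, rfl, RG.nil _, h⟩
    · obtain ⟨f₁, f₂, rfl, h3, h4⟩ := ih t h1 h2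
      exact ⟨a :: f₁, f₂, rfl, RG.new h3, h4⟩

/-- Substitution of the word `g` for the parameters `a, a+1, …`. -/
def wsub (a : ℕ) (g : List ℕ) (x : ℕ) : ℕ := if x < a then x else g.getD (x - a) 0

/-- The shift, skipping the letter `a`. -/
def sh (a x : ℕ) : ℕ := if x < a then x else x + 1

theorem wsub_lt {a x : ℕ} {g : List ℕ} (h : x < a) : wsub a g x = x := by simp [wsub, h]

theorem wsub_sh (a x y : ℕ) (g : List ℕ) : wsub a (x :: g) (sh a y) = wsub a g y := by
  unfold wsub sh
  by_cases h : y < a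
  · simp [h]
  · have : y + 1 - a = (y - a) + 1 := by omega
    have h' : ¬ (y + 1 < a) := by omega
    simp [h, h', this]

theorem wsub_self (a : ℕ) (g : List ℕ) : wsub a (a :: g) = wsub (a + 1) g := by
  funext y
  unfold wsub
  by_cases h : y < a
  · have : y < a + 1 := by omega
    simp [h, this]
  · by_cases h2 : y = a
    · subst h2; simp
    · have h3 : y - a = (y - (a + 1)) + 1 := by omega
      have h4 : ¬ (y < a + 1) := by omega
      simp [h, h3, h4]

theorem wsub_sub {a x : ℕ} {g h : List ℕ} (hx : x < a + g.length) :
    wsub a h (wsub a g x) = wsub a (g.map (wsub a h)) x := by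
  by_cases hxa : x < a
  · simp [wsub_lt hxa]
  · have h1 : x - a < g.length := by omega
    conv_lhs => rw [wsub.eq_def a g]
    conv_rhs => rw [wsub]
    simp [hxa, h1]

theorem map_sub_sub {a : ℕ} {f g h : List ℕ} (hx : ∀ x ∈ f, x < a + g.length) :
    (f.map (wsub a g)).map (wsub a h) = f.map (wsub a (g.map (wsub a h))) := by
  rw [List.map_map]
  apply List.map_congr_left
  intro x hxf
  exact wsub_sub (hx x hxf)

theorem RG.shift {d b : ℕ} {f : List ℕ} (h : RG d f b) (a : ℕ) (had : a ≤ d) :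
    RG (d + 1) (f.map (sh a)) (b + 1) := by
  induction h with
  | nil d => exact RG.nil _
  | @old d b x w hx h ih =>
    refine RG.old ?_ (ih had)
    unfold sh; split_ifs <;> omega
  | @new d b w h ih =>
    have : sh a d = d + 1 := by unfold sh; rw [if_neg (by omega)]
    rw [List.map_cons, this]
    exact RG.new (ih (by omega))

theorem RG.comp_gen {a s b : ℕ} {f : List ℕ} (h : RG s f b) :
    ∀ (g₁ g₂ : List ℕ) (d e : ℕ), s = a + g₁.length → b = a + g₁.length + g₂.length →
      RG a g₁ d → RG d g₂ e → RG d (f.map (wsub a (g₁ ++ g₂))) e := by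
  induction h with
  | nil s =>
    intro g₁ g₂ d e h1 h2 h3 h4
    have : g₂ = [] := List.length_eq_zero_iff.1 (by omega)
    subst this
    exact h4
  | @old s b x w hx h ih =>
    intro g₁ g₂ d e h1 h2 h3 h4
    refine RG.old ?_ (ih g₁ g₂ d e h1 h2 h3 h4)
    have := h3.le
    by_cases hxa : x < a
    · rw [wsub_lt hxa]; omega
    · have h5 : x - a < g₁.length := by omega
      rw [wsub, if_neg hxa, List.getD_append _ _ _ _ h5, List.getD_eq_getElem _ _ h5]
      exact h3.lt _ (List.getElem_mem _)
  | @new s b w h ih =>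
    intro g₁ g₂ d e h1 h2 h3 h4
    have hle := h.le
    cases h4 with
    | nil => simp at h2; omega
    | @old _ _ x w' hx h4 =>
      have := ih (g₁ ++ [x]) w' d e (by simp; omega) (by simp at h2 ⊢; omega)
        (h3.append (RG.old hx (RG.nil _))) h4
      rw [List.append_assoc] at this
      have hs : wsub a (g₁ ++ x :: w') s = x := by
        rw [wsub, if_neg (by omega), List.getD_append_right _ _ _ _ (by omega)]
        have : s - a - g₁.length = 0 := by omega
        simp [this]
      rw [List.map_cons, hs]
      exact RG.old hx this
    | @new _ _ w' h4 =>
      have := ih (g₁ ++ [d]) w' (d + 1) e (by simp; omega) (by simp at h2 ⊢; omega)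
        (h3.append (RG.new (RG.nil _))) h4
      rw [List.append_assoc] at this
      have hs : wsub a (g₁ ++ d :: w') s = d := by
        rw [wsub, if_neg (by omega), List.getD_append_right _ _ _ _ (by omega)]
        have : s - a - g₁.length = 0 := by omega
        simp [this]
      rw [List.map_cons, hs]
      exact RG.new this

theorem RG.comp {a m e : ℕ} {f g : List ℕ} (h : RG a f (a + m)) (hg : RG a g e)
    (hm : g.length = m) : RG a (f.map (wsub a g)) e := by
  have := h.comp_gen (a := a) [] g a e (by simp) (by simp [hm]) (RG.nil a) hg
  simpa using this

/-- Words over the alphabet `{0, …, a-1}` of length `h`. -/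
abbrev Wd (a h : ℕ) : Type := {y : List ℕ // y.length = h ∧ ∀ x ∈ y, x < a}

instance (a h : ℕ) : Finite (Wd a h) := by
  apply Finite.of_surjective
    (fun f : Fin h → Fin a => (⟨List.ofFn fun i => (f i : ℕ), by simp, by
      intro x hx
      rw [List.mem_ofFn] at hx
      obtain ⟨i, rfl⟩ := hx
      exact (f i).2⟩ : Wd a h))
  rintro ⟨y, rfl, hy⟩
  refine ⟨fun i => ⟨y[i], hy _ (List.getElem_mem _)⟩, ?_⟩
  apply Subtype.ext
  simp

/-- Hales-Jewett, in terms of lists. -/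
theorem HJL (a : ℕ) (κ : Type) [Finite κ] [Nonempty κ] : ∃ h, ∀ χ : Wd a h → κ,
    ∃ L : List ℕ, L.length = h ∧ RG a L (a + 1) ∧
      ∃ c, ∀ x < a, ∀ y : Wd a h, y.1 = L.map (wsub a [x]) → χ y = c := by
  obtain ⟨n, hn⟩ := Combinatorics.Subspace.exists_mono_in_high_dimension_fin (Fin a) κ Unit
  refine ⟨n, fun χ => ?_⟩
  obtain ⟨l, c, hl⟩ := hn (fun w => χ ⟨List.ofFn fun i => (w i : ℕ), by simp, by
      intro x hx
      rw [List.mem_ofFn] at hx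
      obtain ⟨i, rfl⟩ := hx
      exact (w i).2⟩)
  refine ⟨List.ofFn fun i => (l.idxFun i).elim (fun x : Fin a => (x : ℕ)) (fun _ => a), by simp, ?_, c, ?_⟩
  · obtain ⟨i, hi⟩ := l.proper ()
    have key : ∀ L : List ℕ, (∀ x ∈ L, x ≤ a) → a ∈ L → RG a L (a + 1) := by
      intro L hL ha
      induction L with
      | nil => simp at ha
      | cons x L ih =>
        by_cases hx : x = a
        · subst hx
          exact RG.new (RG.const fun y hy => Nat.lt_succ_of_le (hL y (by simp [hy])))
        · have := hL x (by simp)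
          refine RG.old (by omega) (ih (fun y hy => hL y (by simp [hy])) ?_)
          rcases List.mem_cons.1 ha with h | h
          · exact absurd h.symm hx
          · exact h
    apply key
    · intro x hx
      rw [List.mem_ofFn] at hx
      obtain ⟨j, rfl⟩ := hx
      cases h : l.idxFun j with
      | inl y => simpa using y.2.le
      | inr y => simp
    · rw [List.mem_ofFn]
      exact ⟨i, by simp [hi]⟩
  · intro x hx y hy
    rw [← hl (fun _ => ⟨x, hx⟩)]
    congr 1
    apply Subtype.ext
    rw [hy, List.map_ofFn]
    congr 1
    funext i
    simp only [Function.comp]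
    rw [Combinatorics.Subspace.coe_apply]
    cases h : l.idxFun i with
    | inl z => simp [wsub]
    | inr z => simp [wsub]

/-- Evaluation of a parameter word at a partial assignment. -/
def ev (a : ℕ) (f u : List ℕ) : List ℕ := (f.takeWhile (fun y => y < a + u.length)).map (wsub a u)

theorem stage2 (a m : ℕ) : ∀ (κ : Type) [Finite κ] [Nonempty κ], ∃ n, ∀ χ : List ℕ → κ,
    ∃ (f : List ℕ) (c : ℕ → κ), f.length = n ∧ RG a f (a + m) ∧
      ∀ u : List ℕ, u.length ≤ m → (∀ x ∈ u, x < a) → χ (ev a f u) = c u.length := by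
  induction m with
  | zero =>
    intro κ _ _
    refine ⟨0, fun χ => ⟨[], fun _ => χ [], rfl, RG.nil a, fun u _ _ => by simp [ev]⟩⟩
  | succ m ih =>
    intro κ _ _
    obtain ⟨h, hh⟩ := HJL a (Fin (m + 1) → κ)
    obtain ⟨n, hn⟩ := ih (Wd a h → κ)
    refine ⟨h + n, fun χ => ?_⟩
    obtain ⟨F, c, hF1, hF2, hF3⟩ := hn (fun w y => χ (y.1 ++ w))
    obtain ⟨L, hL1, hL2, d, hd⟩ := hh (fun y j => c j y)
    refine ⟨L ++ F.map (sh a), fun j => if hj : 1 ≤ j ∧ j - 1 < m + 1 then d ⟨j - 1, hj.2⟩ else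
      χ (ev a (L ++ F.map (sh a)) []), by simp [hL1, hF1], ?_, ?_⟩
    · have := hL2.append (hF2.shift a le_rfl)
      rwa [← add_assoc]
    · intro u hu hua
      cases u with
      | nil => simp
      | cons x u =>
        have hx : x < a := hua x (by simp)
        simp only [List.length_cons] at hu
        have h1 : u.length < m + 1 := by omega
        have e1 : ev a (L ++ F.map (sh a)) (x :: u) = L.map (wsub a [x]) ++ ev a F u := by
          unfold ev
          rw [List.takeWhile_append_of_pos, List.map_append]
          · congr 1
            · apply List.map_congr_left
              intro y hy
              have := hL2.lt y hy
              by_cases hya : y < a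
              · simp [wsub, hya]
              · have : y = a := by omega
                subst this
                simp [wsub]
            · rw [List.takeWhile_map, List.map_map]
              have : (fun y => decide (y < a + (x :: u).length)) ∘ sh a
                  = fun y => decide (y < a + u.length) := by
                funext y
                simp only [Function.comp, List.length_cons, decide_eq_decide]
                unfold sh
                split_ifs <;> omega
              rw [this]
              apply List.map_congr_left
              intro y _
              exact wsub_sh a x y u
          · intro y hy
            have := hL2.lt y hy
            simp; omega
        have hy : (L.map (wsub a [x])).length = h ∧ ∀ z ∈ L.map (wsub a [x]), z < a := by
          refine ⟨by simp [hL1], ?_⟩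
          intro z hz
          rw [List.mem_map] at hz
          obtain ⟨y, hy, rfl⟩ := hz
          have := hL2.lt y hy
          by_cases hya : y < a
          · simp [wsub, hya]
          · have : y = a := by omega
            subst this
            simp [wsub, hx]
        have h2 := congrFun (hF3 u (by omega) (fun y hy => hua y (by simp [hy]))) ⟨_, hy⟩
        have h3 := congrFun (hd x hx ⟨_, hy⟩ rfl) ⟨u.length, h1⟩
        rw [e1]
        simp only [List.length_cons]
        rw [dif_pos (by omega)]
        simp only at h2 h3
        rw [h2, h3]
        congr 1

/-- The dual Ramsey property for `l` parameters over the alphabet of size `a`. -/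
def GR (a l : ℕ) : Prop := ∀ (m : ℕ) (κ : Type) [Finite κ] [Nonempty κ], ∃ n, ∀ χ : List ℕ → κ,
  ∃ (f : List ℕ) (c : κ), f.length = n ∧ RG a f (a + m) ∧
    ∀ g : List ℕ, g.length = m → RG a g (a + l) → χ (f.map (wsub a g)) = c

theorem GR_zero (a : ℕ) : GR a 0 := by
  intro m κ _ _
  obtain ⟨n, hn⟩ := stage2 a m κ
  refine ⟨n, fun χ => ?_⟩
  obtain ⟨f, c, h1, h2, h3⟩ := hn χ
  refine ⟨f, c m, h1, h2, fun g hg hg' => ?_⟩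
  rw [← hg, ← h3 g hg.le hg'.lt]
  unfold ev
  congr 2
  symm
  rw [List.takeWhile_eq_self_iff]
  intro x hx
  simpa [hg] using h2.lt x hx

theorem stage1 (a l : ℕ) (hG : GR (a + 1) l) (m : ℕ) : ∀ (κ : Type) [Finite κ] [Nonempty κ],
    ∃ n, ∀ χ : List ℕ → κ, ∃ f : List ℕ, f.length = n ∧ RG a f (a + m) ∧
      ∀ u v v' : List ℕ, (∀ x ∈ u, x < a) → RG (a + 1) v (a + 1 + l) →
        RG (a + 1) v' (a + 1 + l) → u.length + 1 + v.length = m →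
        u.length + 1 + v'.length = m →
        χ (f.map (wsub a (u ++ a :: v))) = χ (f.map (wsub a (u ++ a :: v'))) := by
  induction m with
  | zero =>
    intro κ _ _
    exact ⟨0, fun χ => ⟨[], rfl, RG.nil a, fun u v v' _ _ _ h => by omega⟩⟩
  | succ m ih =>
    intro κ _ _
    obtain ⟨n₂, hn₂⟩ := ih (Fin a → κ)
    obtain ⟨n₁, hn₁⟩ := hG n₂ κ
    refine ⟨n₁ + 1, fun χ => ?_⟩
    obtain ⟨F₁, c, hF1, hF1', hF1c⟩ := hn₁ (fun w => χ (a :: w))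
    obtain ⟨F₂, hF2, hF2', hF2c⟩ := hn₂ (fun w x => χ (x :: F₁.map (wsub a (x :: w))))
    have hS : RG (a + 1) (F₂.map (sh a)) (a + 1 + m) := by
      have := hF2'.shift a le_rfl
      rwa [show a + 1 + m = a + m + 1 by omega]
    have hSl : (F₂.map (sh a)).length = n₂ := by simp [hF2]
    have hR : RG a (a :: F₁.map (wsub (a + 1) (F₂.map (sh a)))) (a + (m + 1)) := by
      have := hF1'.comp hS hSl
      rw [show a + (m + 1) = a + 1 + m by omega]
      exact RG.new this
    refine ⟨_, by simp [hF1], hR, ?_⟩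
    intro u v v' hu hv hv' hl hl'
    cases u with
    | nil =>
      have key : ∀ v, RG (a + 1) v (a + 1 + l) → ([] : List ℕ).length + 1 + v.length = m + 1 →
          χ ((a :: F₁.map (wsub (a + 1) (F₂.map (sh a)))).map (wsub a ([] ++ a :: v))) = c := by
        intro v hv hl
        simp only [List.length_nil] at hl
        rw [List.nil_append, wsub_self, List.map_cons, wsub_lt (by omega), map_sub_sub]
        · apply hF1c
          · simp [hF2]
          · exact hS.comp hv (by omega)
        · rw [hSl]; exact hF1'.lt
      rw [key v hv hl, key v' hv' hl']
    | cons x u =>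
      have hx : x < a := hu x (by simp)
      have key : ∀ w : List ℕ,
          (a :: F₁.map (wsub (a + 1) (F₂.map (sh a)))).map (wsub a (x :: w))
            = x :: F₁.map (wsub a (x :: F₂.map (wsub a w))) := by
        intro w
        rw [List.map_cons, List.map_map]
        congr 1
        · simp [wsub]
        · apply List.map_congr_left
          intro y hy
          have hy := hF1'.lt y hy
          simp only [Function.comp]
          by_cases h1 : y < a
          · rw [wsub_lt (show y < a + 1 by omega), wsub_lt h1, wsub_lt h1]
          · by_cases h2 : y = a
            · subst h2
              rw [wsub_lt (show y < y + 1 by omega)]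
              simp [wsub]
            · have h3 : ¬ y < a + 1 := by omega
              have h4 : y - (a + 1) < F₂.length := by omega
              have h5 : y - a = (y - (a + 1)) + 1 := by omega
              have e1 : wsub (a + 1) (F₂.map (sh a)) y = sh a (F₂[y - (a + 1)]) := by
                rw [wsub, if_neg h3]; simp [h4]
              have e2 : wsub a (x :: F₂.map (wsub a w)) y = wsub a w (F₂[y - (a + 1)]) := by
                rw [wsub.eq_def a (x :: _), if_neg h1, h5]; simp [h4]
              rw [e1, e2, wsub_sh]
      simp only [List.length_cons] at hl hl'
      have := congrFun (hF2c u v v' (fun y hy => hu y (by simp [hy])) hv hv' (by omega)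
        (by omega)) ⟨x, hx⟩
      rw [List.cons_append, List.cons_append, key, key]
      exact this

theorem stage3 (n : ℕ) : ∀ (P : ℕ → Prop) [DecidablePred P] (b m : ℕ), 1 ≤ b →
    m ≤ Nat.count P n → ∃ f : List ℕ, f.length = n ∧ RG b f (b + m) ∧
      ∀ f₁ t f₂, f = f₁ ++ t :: f₂ → b ≤ t → (∀ x ∈ f₁, x < t) → P f₁.length := by
  induction n with
  | zero =>
    intro P _ b m hb hm
    simp at hm
    subst hm
    exact ⟨[], rfl, RG.nil b, fun f₁ t f₂ h => by simp at h⟩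
  | succ n ih =>
    intro P _ b m hb hm
    rw [Nat.count_succ'] at hm
    by_cases h : P 0 ∧ 1 ≤ m
    · rw [if_pos h.1] at hm
      obtain ⟨f, h1, h2, h3⟩ := ih (fun k => P (k + 1)) (b + 1) (m - 1) (by omega) (by omega)
      refine ⟨b :: f, by simp [h1], RG.new (by
        rwa [show b + m = b + 1 + (m - 1) by omega]), ?_⟩
      intro f₁ t f₂ he hbt hlt
      cases f₁ with
      | nil => exact h.1
      | cons y f₁ =>
        simp only [List.cons_append, List.cons.injEq] at he
        have : y < t := hlt y (by simp)
        exact h3 f₁ t f₂ he.2 (by omega) (fun x hx => hlt x (by simp [hx]))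
    · have hm' : m ≤ Nat.count (fun k => P (k + 1)) n := by
        by_cases h0 : P 0
        · have : m = 0 := by
            by_contra hne
            exact h ⟨h0, by omega⟩
          omega
        · rw [if_neg h0] at hm; omega
      obtain ⟨f, h1, h2, h3⟩ := ih (fun k => P (k + 1)) b m hb hm'
      refine ⟨0 :: f, by simp [h1], RG.old (by omega) h2, ?_⟩
      intro f₁ t f₂ he hbt hlt
      cases f₁ with
      | nil =>
        simp only [List.nil_append, List.cons.injEq] at he
        omega
      | cons y f₁ =>
        simp only [List.cons_append, List.cons.injEq] at he
        exact h3 f₁ t f₂ he.2 hbt (fun x hx => hlt x (by simp [hx]))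

theorem pigeon (κ : Type) [Finite κ] [Nonempty κ] (m : ℕ) : ∃ M, ∀ c : ℕ → κ, ∃ c₀,
    ∀ [DecidablePred fun j => c j = c₀], m ≤ Nat.count (fun j => c j = c₀) M := by
  classical
  cases nonempty_fintype κ
  refine ⟨Fintype.card κ * m, fun c => ?_⟩
  obtain ⟨c₀, -, h⟩ := Finset.exists_le_card_fiber_of_mul_le_card_of_maps_to
    (s := Finset.range (Fintype.card κ * m)) (t := (Finset.univ : Finset κ)) (f := c) (n := m)
    (by simp) Finset.univ_nonempty (by simp)
  refine ⟨c₀, fun {_} => ?_⟩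
  rw [Nat.count_eq_card_filter_range]
  convert h

/-- How composition acts on a word `u a v`. -/
theorem comp_split {a l M : ℕ} {f u v : List ℕ} (hf : RG a f (a + M)) (hu : ∀ x ∈ u, x < a)
    (hv : RG (a + 1) v (a + 1 + l)) (hl : u.length + 1 + v.length = M) :
    ∃ f₁ f₂ v', f = f₁ ++ (a + u.length) :: f₂ ∧ (∀ x ∈ f₁, x < a + u.length) ∧
      f.map (wsub a (u ++ a :: v)) = ev a f u ++ a :: v' ∧
      (ev a f u).length = f₁.length ∧ (∀ x ∈ ev a f u, x < a) ∧
      RG (a + 1) v' (a + 1 + l) := by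
  obtain ⟨f₁, f₂, rfl, h1, h2⟩ := hf.decomp (a + u.length) (by omega) (by omega)
  have hev : ev a (f₁ ++ (a + u.length) :: f₂) u = f₁.map (wsub a u) := by
    unfold ev
    rw [List.takeWhile_append_of_pos (by simpa using h1.lt)]
    simp
  refine ⟨f₁, f₂, f₂.map (wsub a (u ++ a :: v)), rfl, h1.lt, ?_, by simp [hev], ?_, ?_⟩
  · rw [hev, List.map_append, List.map_cons]
    congr 1
    · apply List.map_congr_left
      intro x hx
      have := h1.lt x hx
      by_cases hxa : x < a
      · rw [wsub_lt hxa, wsub_lt hxa]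
      · rw [wsub, wsub, if_neg hxa, if_neg hxa, List.getD_append _ _ _ _ (by omega)]
    · congr 1
      rw [wsub, if_neg (by omega), List.getD_append_right _ _ _ _ (by omega)]
      simp
  · rw [hev]
    intro y hy
    rw [List.mem_map] at hy
    obtain ⟨x, hx, rfl⟩ := hy
    have := h1.lt x hx
    by_cases hxa : x < a
    · rwa [wsub_lt hxa]
    · have h5 : x - a < u.length := by omega
      rw [wsub, if_neg hxa, List.getD_eq_getElem _ _ h5]
      exact hu _ (List.getElem_mem _)
  · have := h2.comp_gen (a := a) (u ++ [a]) v (a + 1) (a + 1 + l) (by simp; omega)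
      (by simp; omega) ((RG.const hu).append (RG.new (RG.nil _))) hv
    rwa [List.append_assoc] at this

theorem GR_succ (a l : ℕ) (hG : GR (a + 1) l) : GR a (l + 1) := by
  classical
  intro m κ _ _
  rcases Nat.eq_zero_or_pos a with rfl | ha
  · obtain ⟨n, hn⟩ := stage1 0 l hG m κ
    refine ⟨n, fun χ => ?_⟩
    obtain ⟨f, h1, h2, h3⟩ := hn χ
    by_cases hex : ∃ g : List ℕ, g.length = m ∧ RG 0 g (0 + (l + 1))
    · obtain ⟨g₀, hg₀, hg₀'⟩ := hex
      refine ⟨f, χ (f.map (wsub 0 g₀)), h1, h2, fun g hg hg' => ?_⟩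
      have key : ∀ g, RG 0 g (0 + (l + 1)) → ∃ v, g = [] ++ 0 :: v ∧ RG (0 + 1) v (0 + 1 + l) := by
        intro g hg
        obtain ⟨g₁, g₂, rfl, h4, h5⟩ := hg.decomp 0 le_rfl (by omega)
        have : g₁ = [] := by
          rw [List.eq_nil_iff_forall_not_mem]
          intro x hx
          exact absurd (h4.lt x hx) (by omega)
        subst this
        refine ⟨g₂, rfl, ?_⟩
        rwa [show 0 + 1 + l = 0 + (l + 1) by omega]
      obtain ⟨v, rfl, hv⟩ := key g hg'
      obtain ⟨v₀, rfl, hv₀⟩ := key g₀ hg₀'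
      simp at hg hg₀
      exact h3 [] v v₀ (by simp) hv hv₀ (by simp; omega) (by simp; omega)
    · exact ⟨f, χ [], h1, h2, fun g hg hg' => absurd ⟨g, hg, hg'⟩ hex⟩
  · obtain ⟨M, hM⟩ := pigeon κ m
    obtain ⟨n₂, hn₂⟩ := stage2 a M κ
    obtain ⟨n₁, hn₁⟩ := stage1 a l hG n₂ κ
    refine ⟨n₁, fun χ => ?_⟩
    obtain ⟨f₁, hf1, hf1', hf1c⟩ := hn₁ χ
    let ψ : List ℕ → κ := fun u =>
      if h : ∃ v, RG (a + 1) v (a + 1 + l) ∧ u.length + 1 + v.length = n₂ then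
        χ (f₁.map (wsub a (u ++ a :: h.choose))) else χ []
    have hψ : ∀ u v, (∀ x ∈ u, x < a) → RG (a + 1) v (a + 1 + l) →
        u.length + 1 + v.length = n₂ → χ (f₁.map (wsub a (u ++ a :: v))) = ψ u := by
      intro u v hu hv hl
      have h : ∃ v, RG (a + 1) v (a + 1 + l) ∧ u.length + 1 + v.length = n₂ := ⟨v, hv, hl⟩
      simp only [ψ]
      rw [dif_pos h]
      exact hf1c u v _ hu hv h.choose_spec.1 hl h.choose_spec.2
    obtain ⟨f₂, c, hf2, hf2', hf2c⟩ := hn₂ ψ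
    obtain ⟨c₀, hc₀⟩ := hM c
    obtain ⟨f₃, hf3, hf3', hf3c⟩ := stage3 M (fun j => c j = c₀) a m ha hc₀
    have h23 : RG a (f₂.map (wsub a f₃)) (a + m) := hf2'.comp hf3' hf3
    refine ⟨f₁.map (wsub a (f₂.map (wsub a f₃))), c₀, by simp [hf1], hf1'.comp h23 (by simp [hf2]), ?_⟩
    intro g hg hg'
    rw [map_sub_sub (by simpa [hf2] using hf1'.lt), map_sub_sub (by simpa [hf3] using hf2'.lt)]
    obtain ⟨u, v, rfl, hu, hv⟩ := hg'.decomp a le_rfl (by omega)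
    rw [show a + (l + 1) = a + 1 + l by omega] at hv
    obtain ⟨p₁, p₂, v₁, e1, e2, e3, e4, e5, e6⟩ :=
      comp_split hf3' hu.lt hv (by simpa [add_assoc, add_comm 1] using hg)
    have hlen1 : (ev a f₃ u).length + 1 + v₁.length = M := by
      have := congrArg List.length e3
      simp [hf3] at this
      omega
    rw [e3]
    obtain ⟨q₁, q₂, v₂, d1, d2, d3, d4, d5, d6⟩ := comp_split hf2' e5 e6 hlen1
    have hlen2 : (ev a f₂ (ev a f₃ u)).length + 1 + v₂.length = n₂ := by
      have := congrArg List.length d3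
      simp [hf2] at this
      omega
    rw [d3, hψ _ _ d5 d6 hlen2, hf2c _ (by omega) e5, e4]
    exact hf3c p₁ _ p₂ e1 (by omega) e2

theorem GR_all (l : ℕ) : ∀ a, GR a l := by
  induction l with
  | zero => exact GR_zero
  | succ l ih => exact fun a => GR_succ a l (ih (a + 1))

theorem RG.mem {a b x : ℕ} {f : List ℕ} (h : RG a f b) (h1 : a ≤ x) (h2 : x < b) : x ∈ f := by
  obtain ⟨f₁, f₂, rfl, -, -⟩ := h.decomp x h1 h2
  simp

/-- Numbering the letters of a list by order of first appearance. -/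
theorem numbering {α : Type} [BEq α] [LawfulBEq α] (W : List α) : ∀ D₀ : List α, D₀.Nodup →
    ∃ D₁, (D₀ ++ D₁).Nodup ∧ (∀ x, x ∈ D₀ ++ D₁ ↔ x ∈ D₀ ∨ x ∈ W) ∧
      ∀ D₂, RG D₀.length (W.map fun x => (D₀ ++ D₁ ++ D₂).idxOf x) (D₀ ++ D₁).length := by
  induction W with
  | nil =>
    intro D₀ h
    refine ⟨[], by simpa using h, by simp, fun D₂ => ?_⟩
    simpa using RG.nil _
  | cons x W ih =>
    intro D₀ h
    by_cases hx : x ∈ D₀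
    · obtain ⟨D₁, h1, h2, h3⟩ := ih D₀ h
      refine ⟨D₁, h1, ?_, fun D₂ => ?_⟩
      · intro y
        rw [h2, List.mem_cons]
        constructor
        · tauto
        · rintro (h | rfl | h)
          · exact Or.inl h
          · exact Or.inl hx
          · exact Or.inr h
      · refine RG.old ?_ (h3 D₂)
        simp only [List.append_assoc]
        rw [List.idxOf_append_of_mem hx]
        exact List.idxOf_lt_length_iff.2 hx
    · obtain ⟨D₁, h1, h2, h3⟩ := ih (D₀ ++ [x]) (by
        rw [List.nodup_append]
        refine ⟨h, by simp, ?_⟩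
        intro a ha b hb
        simp at hb
        rintro rfl
        exact hx (hb ▸ ha))
      rw [List.append_assoc] at h1
      refine ⟨x :: D₁, h1, ?_, fun D₂ => ?_⟩
      · intro y
        have := h2 y
        rw [List.append_assoc] at this
        rw [show D₀ ++ x :: D₁ = D₀ ++ ([x] ++ D₁) from rfl, this]
        simp only [List.mem_append, List.mem_cons, List.not_mem_nil, or_false]
        tauto
      · have := h3 D₂
        simp only [List.length_append, List.length_cons, List.length_nil, List.append_assoc,
          List.cons_append, List.nil_append] at this
        have e : (D₀ ++ x :: (D₁ ++ D₂)).idxOf x = D₀.length := by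
          rw [List.idxOf_append_of_notMem hx]; simp
        simp only [List.length_append, List.length_cons, List.append_assoc, List.cons_append,
          List.map_cons, e]
        refine RG.new ?_
        convert this using 1

theorem stmt_11 (A : Type) [Fintype A] (ρA : A → A → Prop) (hA : IsGraphRel ρA)
    (p m : ℕ) (hp : Fintype.card A = p)
    (hm : {e : A × A | ρA e.1 e.2 ∧ e.1 ≠ e.2}.ncard = m)
    (k : ℕ) (hk : 1 ≤ k)
    (B : Type) [Fintype B] (ρB : B → B → Prop) (hB : IsGraphRel ρB) :
    ∃ (C : Type) (ρC : C → C → Prop), Finite C ∧ IsGraphRel ρC ∧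
      ∀ χ : {f : C → A // IsQuot ρC ρA f} → Fin k,
        ∃ w : C → B, IsQuot ρC ρB w ∧
          {c : Fin k | ∃ g : {f : C → A // IsQuot ρC ρA f},
              (∃ f : B → A, IsQuot ρB ρA f ∧ g.1 = f ∘ w) ∧ χ g = c}.ncard ≤
            Nat.factorial p * Nat.factorial m := by
  classical
  -- lists of loops and of non-loops
  let L₁ : List (A × A) := (Finset.univ : Finset A).toList.map fun x => (x, x)
  let L₂ : List (A × A) := (Finset.univ.filter fun e : A × A => ρA e.1 e.2 ∧ e.1 ≠ e.2).toList
  have hL₁ : ∀ e, e ∈ L₁ ↔ e.1 = e.2 := by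
    rintro ⟨x, y⟩
    simp [L₁]
  have hL₂ : ∀ e, e ∈ L₂ ↔ ρA e.1 e.2 ∧ e.1 ≠ e.2 := by
    intro e
    simp [L₂]
  have hL₁n : L₁.Nodup := by
    refine List.Nodup.map ?_ (Finset.nodup_toList _)
    intro x y h
    exact (Prod.ext_iff.1 h).1
  have hL₂n : L₂.Nodup := Finset.nodup_toList _
  have hL₁l : L₁.length = p := by simp [L₁, hp]
  have hL₂l : L₂.length = m := by
    rw [← hm, Set.ncard_eq_toFinset_card']
    simp [L₂]
  let LB₁ : List (B × B) := (Finset.univ : Finset B).toList.map fun x => (x, x)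
  let LB₂ : List (B × B) := (Finset.univ.filter fun e : B × B => ρB e.1 e.2 ∧ e.1 ≠ e.2).toList
  let LB : List (B × B) := LB₁ ++ LB₂
  have hLB : ∀ e, e ∈ LB ↔ ρB e.1 e.2 := by
    rintro ⟨x, y⟩
    simp only [LB, LB₁, LB₂, List.mem_append, List.mem_map, Finset.mem_toList, Finset.mem_univ,
      true_and, Finset.mem_filter, Prod.mk.injEq]
    constructor
    · rintro (⟨z, rfl, rfl⟩ | h)
      · exact hB.1 z
      · exact h.1
    · intro h
      by_cases hxy : x = y
      · exact Or.inl ⟨x, rfl, hxy⟩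
      · exact Or.inr ⟨h, hxy⟩
  let I : Finset (List (A × A) × List (A × A)) :=
    L₁.permutations.toFinset ×ˢ L₂.permutations.toFinset
  have hI : I.card ≤ Nat.factorial p * Nat.factorial m := by
    simp only [I, Finset.card_product]
    apply Nat.mul_le_mul
    · refine (List.toFinset_card_le _).trans ?_
      rw [List.length_permutations, hL₁l]
    · refine (List.toFinset_card_le _).trans ?_
      rw [List.length_permutations, hL₂l]
  have hID : ∀ D ∈ I, ∀ e : A × A, ρA e.1 e.2 → e ∈ D.1 ++ D.2 := by
    rintro ⟨D₁, D₂⟩ hD e he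
    simp only [I, Finset.mem_product, List.mem_toFinset, List.mem_permutations] at hD
    rw [List.mem_append, hD.1.mem_iff, hD.2.mem_iff, hL₁, hL₂]
    tauto
  haveI : Nonempty (Fin k) := ⟨⟨0, hk⟩⟩
  obtain ⟨N, hN⟩ := GR_all (p + m) 0 LB.length (I → Fin k)
  let ρC : Fin N × Bool → Fin N × Bool → Prop := fun x y => x.1 = y.1
  refine ⟨Fin N × Bool, ρC, inferInstance, ⟨fun x => rfl, fun x y h => Eq.symm h⟩, fun χ => ?_⟩
  let code : List (A × A) × List (A × A) → (Fin N × Bool → A) → List ℕ := fun D g =>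
    List.ofFn fun i : Fin N => (D.1 ++ D.2).idxOf (g (i, true), g (i, false))
  have hcode : ∀ D ∈ I, ∀ g g' : {f : Fin N × Bool → A // IsQuot ρC ρA f},
      code D g.1 = code D g'.1 → g = g' := by
    intro D hD g g' h
    simp only [code] at h
    have h := List.ofFn_injective h
    apply Subtype.ext
    have h' : ∀ i, (g.1 (i, true), g.1 (i, false)) = (g'.1 (i, true), g'.1 (i, false)) := by
      intro i
      have hi := congrFun h i
      refine (List.idxOf_inj ?_).1 hi
      exact hID D hD _ (g.2.2.1 _ _ rfl)
    funext ⟨i, b⟩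
    have := Prod.ext_iff.1 (h' i)
    cases b
    · exact this.2
    · exact this.1
  obtain ⟨t, c, ht1, ht2, ht3⟩ := hN (fun w D =>
    if h : ∃ g : {f : Fin N × Bool → A // IsQuot ρC ρA f}, code D.1 g.1 = w then χ h.choose
    else ⟨0, hk⟩)
  rw [zero_add] at ht2
  have hlt : ∀ i : Fin N, t[(i : ℕ)]'(by rw [ht1]; exact i.2) < LB.length := fun i =>
    ht2.lt _ (List.getElem_mem _)
  let w₀ : Fin N → B × B := fun i => LB[t[(i : ℕ)]'(by rw [ht1]; exact i.2)]'(hlt i)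
  let w : Fin N × Bool → B := fun x => if x.2 then (w₀ x.1).1 else (w₀ x.1).2
  have hw₀ : ∀ i, ρB (w₀ i).1 (w₀ i).2 := fun i => (hLB _).1 (List.getElem_mem _)
  have hw₀s : ∀ e : B × B, ρB e.1 e.2 → ∃ i, w₀ i = e := by
    intro e he
    obtain ⟨j, hj, rfl⟩ := List.getElem_of_mem ((hLB e).2 he)
    obtain ⟨i, hi, hij⟩ := List.getElem_of_mem (ht2.mem (Nat.zero_le j) hj)
    refine ⟨⟨i, by rw [← ht1]; exact hi⟩, ?_⟩
    simp only [w₀, hij]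
  have hw : IsQuot ρC ρB w := by
    refine ⟨?_, ?_, ?_⟩
    · intro b
      obtain ⟨i, hi⟩ := hw₀s (b, b) (hB.1 b)
      exact ⟨(i, true), by simp [w, hi]⟩
    · rintro ⟨i, b⟩ ⟨j, b'⟩ h
      obtain rfl : i = j := h
      cases b <;> cases b' <;> simp only [w]
      · exact hB.1 _
      · exact hB.2 (hw₀ i)
      · exact hw₀ i
      · exact hB.1 _
    · intro u v huv
      obtain ⟨i, hi⟩ := hw₀s (u, v) huv
      exact ⟨(i, true), (i, false), rfl, by simp [w, hi], by simp [w, hi]⟩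
  refine ⟨w, hw, le_trans ?_ hI⟩
  have hsub : {c : Fin k | ∃ g : {f : Fin N × Bool → A // IsQuot ρC ρA f},
      (∃ f : B → A, IsQuot ρB ρA f ∧ g.1 = f ∘ w) ∧ χ g = c} ⊆
      ((Finset.univ.image c : Finset (Fin k)) : Set (Fin k)) := by
    rintro _ ⟨g, ⟨f, hf, hg⟩, rfl⟩
    let W₁ := LB₁.map fun e => (f e.1, f e.2)
    let W₂ := LB₂.map fun e => (f e.1, f e.2)
    have hW₁ : ∀ e, e ∈ W₁ ↔ e.1 = e.2 := by
      rintro ⟨x, y⟩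
      simp only [W₁, LB₁, List.map_map, List.mem_map, Finset.mem_toList, Finset.mem_univ,
        true_and, Function.comp, Prod.mk.injEq]
      constructor
      · rintro ⟨z, rfl, h⟩
        exact h
      · rintro rfl
        obtain ⟨z, rfl⟩ := hf.1 x
        exact ⟨z, rfl, rfl⟩
    have hW₂ : ∀ e : A × A, e.1 ≠ e.2 → (e ∈ W₂ ↔ ρA e.1 e.2) := by
      rintro ⟨x, y⟩ hxy
      simp only [W₂, LB₂, List.mem_map, Finset.mem_toList, Finset.mem_univ,
        true_and, Finset.mem_filter, Prod.mk.injEq]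
      constructor
      · rintro ⟨z, hz, rfl, rfl⟩
        exact hf.2.1 _ _ hz.1
      · intro h
        obtain ⟨a, b, hab, rfl, rfl⟩ := hf.2.2 x y h
        exact ⟨(a, b), ⟨hab, fun h => hxy (congrArg f h)⟩, rfl, rfl⟩
    obtain ⟨D₁, h1, h2, h3⟩ := numbering W₁ [] List.nodup_nil
    simp only [List.nil_append, List.not_mem_nil, false_or, List.length_nil] at h1 h2 h3
    obtain ⟨D₂, h4, h5, h6⟩ := numbering W₂ D₁ h1
    have hp1 : D₁.Perm L₁ := by
      rw [List.perm_ext_iff_of_nodup h1 hL₁n]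
      intro e
      rw [h2, hW₁, hL₁]
    have h4' := List.nodup_append.1 h4
    have hp2 : D₂.Perm L₂ := by
      rw [List.perm_ext_iff_of_nodup h4'.2.1 hL₂n]
      intro e
      have h7 := h5 e
      rw [List.mem_append, h2, hW₁] at h7
      rw [hL₂]
      by_cases he : e.1 = e.2
      · constructor
        · intro h
          have : e ∈ D₁ := by rw [h2, hW₁]; exact he
          exact absurd rfl (h4'.2.2 e this e h)
        · intro h; exact absurd he h.2
      · rw [hW₂ e he] at h7
        tauto
    have hD : (D₁, D₂) ∈ I := by
      simp only [I, Finset.mem_product, List.mem_toFinset, List.mem_permutations]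
      exact ⟨hp1, hp2⟩
    let gw : List ℕ := LB.map fun e => (D₁ ++ D₂).idxOf (f e.1, f e.2)
    have hgw : RG 0 gw (0 + (p + m)) := by
      have h8 := (h3 D₂).append (by simpa using h6 [])
      simp only [W₁, W₂, List.map_map] at h8
      rw [hp1.length_eq, hp2.length_eq, hL₁l, hL₂l] at h8
      simp only [gw, LB, List.map_append, zero_add]
      exact h8
    have hcg : code (D₁, D₂) g.1 = t.map (wsub 0 gw) := by
      apply List.ext_getElem
      · simp [code, ht1]
      · intro i hi hi'
        have hiN : i < N := by simpa [code] using hi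
        have := hlt ⟨i, hiN⟩
        simp only at this
        simp only [code, List.getElem_ofFn, List.getElem_map, wsub, Nat.not_lt_zero, if_false,
          Nat.sub_zero, hg]
        rw [List.getD_eq_getElem _ _ (by simpa [gw] using this)]
        simp [gw, w, w₀]
    have h9 := congrFun (ht3 gw (by simp [gw]) hgw) ⟨(D₁, D₂), hD⟩
    have hex : ∃ g : {f : Fin N × Bool → A // IsQuot ρC ρA f},
        code (D₁, D₂) g.1 = t.map (wsub 0 gw) := ⟨g, hcg⟩
    simp only at h9
    rw [dif_pos hex] at h9
    have h10 : hex.choose = g := hcode _ hD _ _ (hex.choose_spec.trans hcg.symm)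
    rw [h10] at h9
    rw [h9]
    simp
  refine (Set.ncard_le_ncard hsub (Finset.finite_toSet _)).trans ?_
  rw [Set.ncard_coe_finset]
  refine Finset.card_image_le.trans ?_
  simp
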